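/- arXiv:2006.15886 — 3 statements merged into one kernel-verified Lean document; each statement's English description precedes it below -/
import Mathlib

section
/- Let n ∈ ℕ, let V : ℝⁿ → ℝ be continuous, and let x̄ ∈ ℝⁿ satisfy V(x̄) = 0 and V(x) > 0 for all x ≠ x̄. Let c : ℝⁿ → ℝ satisfy c(x̄) = 0 and suppose x̄ belongs to the closure of {x ∈ ℝⁿ : c(x) < 0}. Then the admissible-level set A equals the interval (−∞, 0]; in particular sSup A = 0. (This is the second part of Lemma 1: if the constraint is active at the equilibrium and violated arbitrarily close to it, then the largest safe level Γ*(r) is zero.) -/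
/-- **Lemma 1, second part.** If the continuous Lyapunov-type function `V` has its unique
zero at the equilibrium `xbar`, the constraint is active there (`c xbar = 0`), and the
constraint is violated arbitrarily close to `xbar` (`xbar` is in the closure of
`{x : c x < 0}`), then the admissible-level set
`A = {Γ : {x : V x ≤ Γ} ⊆ {x : 0 ≤ c x}}` equals `(-∞, 0]`, and `sSup A = 0`
(the largest safe level is zero). -/
theorem admissible_levels_eq_Iic_zero_of_active_constraint
    (n : ℕ) (V : (Fin n → ℝ) → ℝ) (hVcont : Continuous V)
    (xbar : Fin n → ℝ) (hV0 : V xbar = 0) (hVpos : ∀ x : Fin n → ℝ, x ≠ xbar → 0 < V x)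
    (c : (Fin n → ℝ) → ℝ) (hcxbar : c xbar = 0)
    (hclosure : xbar ∈ closure {x : Fin n → ℝ | c x < 0}) :
    {Γ : ℝ | {x : Fin n → ℝ | V x ≤ Γ} ⊆ {x : Fin n → ℝ | 0 ≤ c x}} = Set.Iic (0 : ℝ) ∧
      sSup {Γ : ℝ | {x : Fin n → ℝ | V x ≤ Γ} ⊆ {x : Fin n → ℝ | 0 ≤ c x}} = 0 := by
  have hA : {Γ : ℝ | {x : Fin n → ℝ | V x ≤ Γ} ⊆ {x : Fin n → ℝ | 0 ≤ c x}} =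
      Set.Iic (0 : ℝ) := by
    ext Γ
    constructor
    · intro hΓ
      by_contra hpos
      have hpos : 0 < Γ := not_le.mp hpos
      obtain ⟨x, hxV, hxc⟩ := mem_closure_iff.mp hclosure {x | V x < Γ}
        (isOpen_lt hVcont continuous_const) (show V xbar < Γ from hV0.trans_lt hpos)
      have hx : 0 ≤ c x := hΓ (show V x ≤ Γ from le_of_lt hxV)
      exact absurd hxc (not_lt.mpr hx)
    · intro hΓ x hx
      have hxV : V x ≤ 0 := le_trans hx hΓ
      have hxbar : x = xbar := by
        by_contra hne
        exact absurd (hVpos x hne) (not_lt.mpr hxV)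
      exact (hxbar ▸ hcxbar.ge : 0 ≤ c x)
  exact ⟨hA, hA ▸ csSup_Iic⟩
end

section
/- Let n ∈ ℕ, let V : ℝⁿ → ℝ be continuous and coercive, and let c : ℝⁿ → ℝ be continuous. Suppose the admissible-level set A is nonempty and bounded above, and that Γ* := sSup A belongs to A. Then there exists a point x* ∈ ℝⁿ with V(x*) ≤ Γ* and c(x*) = 0; that is, the supremal safe sublevel set {x : V(x) ≤ Γ*} touches the boundary {x : c(x) = 0} of the constraint. (This is the key existence step, equation (19), in the proof of Lemma 1.) -/
/-- **Existence step (equation (19)) in the proof of Lemma 1.** Let `V` be continuous and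
coercive and `c` be continuous. If the admissible-level set
`A = {Γ : {x : V x ≤ Γ} ⊆ {x : 0 ≤ c x}}` is nonempty and bounded above, and its
supremum `Γ* = sSup A` belongs to `A`, then the supremal safe sublevel set
`{x : V x ≤ Γ*}` touches the boundary of the constraint: there is a point `xstar` with
`V xstar ≤ Γ*` and `c xstar = 0`. -/
theorem exists_boundary_point_at_supremal_level
    (n : ℕ) (V : (Fin n → ℝ) → ℝ) (hVcont : Continuous V)
    (hVcoercive : Filter.Tendsto V (Filter.cocompact (Fin n → ℝ)) Filter.atTop)
    (c : (Fin n → ℝ) → ℝ) (hccont : Continuous c)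
    (hne : ({Γ : ℝ | {x : Fin n → ℝ | V x ≤ Γ} ⊆ {x : Fin n → ℝ | 0 ≤ c x}}).Nonempty)
    (hbdd : BddAbove {Γ : ℝ | {x : Fin n → ℝ | V x ≤ Γ} ⊆ {x : Fin n → ℝ | 0 ≤ c x}})
    (hmem : sSup {Γ : ℝ | {x : Fin n → ℝ | V x ≤ Γ} ⊆ {x : Fin n → ℝ | 0 ≤ c x}} ∈
      {Γ : ℝ | {x : Fin n → ℝ | V x ≤ Γ} ⊆ {x : Fin n → ℝ | 0 ≤ c x}}) :
    ∃ xstar : Fin n → ℝ,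
      V xstar ≤ sSup {Γ : ℝ | {x : Fin n → ℝ | V x ≤ Γ} ⊆ {x : Fin n → ℝ | 0 ≤ c x}} ∧
      c xstar = 0 := by
  set A : Set ℝ := {Γ : ℝ | {x : Fin n → ℝ | V x ≤ Γ} ⊆ {x : Fin n → ℝ | 0 ≤ c x}}
  have key : ∀ Γ, sSup A < Γ → ∃ y, V y ≤ Γ ∧ c y < 0 := by
    intro Γ hΓ
    by_contra! h
    exact (le_csSup hbdd (show Γ ∈ A from fun y hy => h y hy)).not_gt hΓ
  obtain ⟨y₀, -, hy₀⟩ := key (sSup A + 1) (lt_add_one _)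
  obtain ⟨x, hx, hmin⟩ := hVcont.continuousOn.exists_isMinOn'
    (isClosed_le hccont continuous_const) (show y₀ ∈ {x | c x ≤ 0} from hy₀.le)
    ((hVcoercive.eventually_ge_atTop (V y₀)).filter_mono inf_le_left)
  have hVx : V x ≤ sSup A := by
    refine le_of_forall_gt_imp_ge_of_dense fun Γ hΓ => ?_
    obtain ⟨y, hyV, hyc⟩ := key Γ hΓ
    exact (hmin (show y ∈ {x | c x ≤ 0} from hyc.le)).trans hyV
  exact ⟨x, hVx, le_antisymm hx (hmem hVx)⟩
end

section
/- Let n, p, m ∈ ℕ and work in ℝ[x₁,…,x_n, r₁,…,r_p]. Let V, c, q be polynomials in (x,r), let Γ̂, c̄₁,…,c̄_m be polynomials in r only, and let s₁,…,s_m be sum-of-squares polynomials in (x,r), and suppose V − Γ̂ + q·c − Σ_{j=1}^m s_j·c̄_j is a sum of squares. Fix r ∈ ℝᵖ with c̄_j(r) ≥ 0 for all j, and suppose the strict sublevel set S(r) = {x ∈ ℝⁿ : V(x,r) < Γ̂(r)} is preconnected and contains a point x̄ with c(x̄,r) > 0. Then S(r) ⊆ {x ∈ ℝⁿ : c(x,r)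 > 0}; i.e., the SOS certificate (14) guarantees that, for every admissible reference, the strict Lyapunov sublevel set of level Γ̂(r) is fully contained in the constraint set. (Main soundness theorem of the proposed method, single constraint.) -/
open MvPolynomial

/-- A polynomial is a sum of squares if it is a finite sum of squares of polynomials. -/
def IsSOS {σ : Type*} (s : MvPolynomial σ ℝ) : Prop :=
  ∃ (k : ℕ) (p : Fin k → MvPolynomial σ ℝ), s = ∑ i, p i ^ 2

/-- A sum of squares takes nonnegative values. -/
theorem IsSOS.eval_nonneg {σ : Type*} {s : MvPolynomial σ ℝ} (hs : IsSOS s) (y : σ → ℝ) :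
    0 ≤ eval y s := by
  obtain ⟨k, p, rfl⟩ := hs
  simp only [map_sum, map_pow]
  positivity

/-- **Main soundness theorem of the proposed method (single constraint).** Suppose the SOS
certificate (14) holds: `V - Γ̂ + q·c - Σⱼ sⱼ·c̄ⱼ` is a sum of squares, with each `sⱼ` SOS
and `Γ̂`, `c̄ⱼ` polynomials in `r` only. Fix an admissible reference `r` (that is,
`c̄ⱼ(r) ≥ 0` for every `j`), and suppose the strict sublevel set
`S(r) = {x : V(x,r) < Γ̂(r)}` is preconnected and contains a point `xbar` with
`c(xbar,r) > 0`. Then `S(r) ⊆ {x : c(x,r) > 0}`: the strict Lyapunov sublevel set of level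
`Γ̂(r)` is fully contained in the constraint set. -/
theorem sos_certificate_strict_sublevel_subset_constraint
    (n p m : ℕ) (V c q : MvPolynomial (Fin n ⊕ Fin p) ℝ)
    (Γhat : MvPolynomial (Fin p) ℝ) (cbar : Fin m → MvPolynomial (Fin p) ℝ)
    (s : Fin m → MvPolynomial (Fin n ⊕ Fin p) ℝ) (hs : ∀ j, IsSOS (s j))
    (hcert : IsSOS (V - rename Sum.inr Γhat + q * c -
      ∑ j, s j * rename Sum.inr (cbar j)))
    (r : Fin p → ℝ) (hr : ∀ j, 0 ≤ eval r (cbar j))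
    (hconn : IsPreconnected {x : Fin n → ℝ | eval (Sum.elim x r) V < eval r Γhat})
    (xbar : Fin n → ℝ) (hxbarS : eval (Sum.elim xbar r) V < eval r Γhat)
    (hcxbar : 0 < eval (Sum.elim xbar r) c) :
    {x : Fin n → ℝ | eval (Sum.elim x r) V < eval r Γhat} ⊆
      {x : Fin n → ℝ | 0 < eval (Sum.elim x r) c} := by
  intro x hx
  by_contra hneg
  have hcont : Continuous fun z : Fin n → ℝ => eval (Sum.elim z r) c := by
    refine (MvPolynomial.continuous_eval c).comp (continuous_pi fun i => ?_)
    cases i with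
    | inl i => exact continuous_apply i
    | inr i => exact continuous_const
  obtain ⟨z, hzS, hz⟩ := hconn.intermediate_value hx hxbarS hcont.continuousOn
    ⟨not_lt.mp hneg, hcxbar.le⟩
  have hcertz := hcert.eval_nonneg (Sum.elim z r)
  have hsum : 0 ≤ ∑ j, eval (Sum.elim z r) (s j) * eval r (cbar j) :=
    Finset.sum_nonneg fun j _ => mul_nonneg ((hs j).eval_nonneg _) (hr j)
  simp only [map_sub, map_add, map_mul, map_sum, eval_rename, Sum.elim_comp_inr] at hcertz
  simp only [Set.mem_ofPred_eq] at hzS hz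
  rw [hz, mul_zero] at hcertz
  linarith
end
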